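/- arXiv:2409.02761 — 3 statements merged into one kernel-verified Lean document; each statement's English description precedes it below -/
import Mathlib

section
/- Let H and X be real Hilbert spaces, G : X → H a bounded linear operator with Hilbert-space adjoint G* : H → X, and T : X → X a bounded linear operator that is coercive, i.e. there exists c > 0 with ⟨T ξ, ξ⟩ ≥ c‖ξ‖² for all ξ ∈ X. Assume the operator A := G ∘ T ∘ G* : H → H is self-adjoint, and let S : H → H be a positive self-adjoint square root of A, i.e. S is bounded, self-adjoint, satisfies ⟨S f, f⟩ ≥ 0 for all f ∈ H, and S ∘ S = A. Then range(S) = range(G). (This range identity is the abstract content of the paper's factorization method theorem characterizing the corroded region via Range(|Λ − Λ₀|^{1/2}) = Range(G).) -/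
open scoped RealInnerProductSpace

/-- Range inclusion part of Douglas' lemma: if `‖P* f‖ ≤ k ‖Q* f‖` for all `f`, then
`range P ⊆ range Q`. -/
theorem range_subset_range_of_norm_adjoint_le {E F H : Type*}
    [NormedAddCommGroup H] [InnerProductSpace ℝ H] [CompleteSpace H]
    [NormedAddCommGroup E] [InnerProductSpace ℝ E] [CompleteSpace E]
    [NormedAddCommGroup F] [InnerProductSpace ℝ F] [CompleteSpace F]
    (P : E →L[ℝ] H) (Q : F →L[ℝ] H) (k : ℝ)
    (h : ∀ f, ‖ContinuousLinearMap.adjoint P f‖ ≤ k * ‖ContinuousLinearMap.adjoint Q f‖) :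
    Set.range P ⊆ Set.range Q := by
  rintro _ ⟨x, rfl⟩
  let R : H →ₗ[ℝ] F := (ContinuousLinearMap.adjoint Q : H →L[ℝ] F).toLinearMap
  let φ : H →ₗ[ℝ] ℝ := (innerSL ℝ (P x)).toLinearMap
  have hφ : ∀ f, ‖φ f‖ ≤ ‖x‖ * k * ‖R f‖ := fun f => by
    have h1 : φ f = ⟪x, ContinuousLinearMap.adjoint P f⟫ := by
      rw [ContinuousLinearMap.adjoint_inner_right]; rfl
    rw [h1, mul_assoc]
    exact (norm_inner_le_norm _ _).trans (mul_le_mul_of_nonneg_left (h f) (norm_nonneg x))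
  have hker : R.ker ≤ φ.ker := fun f hf => by
    have h1 := hφ f
    rw [LinearMap.mem_ker.1 hf, norm_zero, mul_zero] at h1
    exact norm_le_zero_iff.1 h1
  let ψ : R.range →ₗ[ℝ] ℝ := (R.ker.liftQ φ hker) ∘ₗ R.quotKerEquivRange.symm.toLinearMap
  have hψ : ∀ f, ψ ⟨R f, LinearMap.mem_range_self R f⟩ = φ f := fun f => by
    have h1 : R.quotKerEquivRange.symm ⟨R f, LinearMap.mem_range_self R f⟩ =
        Submodule.Quotient.mk f := by
      rw [LinearEquiv.symm_apply_eq]; rfl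
    change R.ker.liftQ φ hker (R.quotKerEquivRange.symm _) = _
    rw [h1, Submodule.liftQ_apply]
  obtain ⟨g, hg, -⟩ := exists_extension_norm_eq R.range
    (ψ.mkContinuous (‖x‖ * k) (by
      rintro ⟨_, f, rfl⟩
      rw [hψ]
      exact hφ f))
  refine ⟨(InnerProductSpace.toDual ℝ F).symm g, ext_inner_right ℝ fun f => ?_⟩
  rw [← ContinuousLinearMap.adjoint_inner_right, InnerProductSpace.toDual_symm_apply]
  exact (hg ⟨R f, LinearMap.mem_range_self R f⟩).trans (hψ f)

/-- Abstract factorization method range identity: if `A = G T G*` with `T` coercive and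
`A` self-adjoint, and `S` is a positive self-adjoint square root of `A`, then
`range S = range G`. -/
theorem stmt_3 {H X : Type*}
    [NormedAddCommGroup H] [InnerProductSpace ℝ H] [CompleteSpace H]
    [NormedAddCommGroup X] [InnerProductSpace ℝ X] [CompleteSpace X]
    (G : X →L[ℝ] H) (T : X →L[ℝ] X)
    (hT : ∃ c > 0, ∀ ξ : X, c * ‖ξ‖ ^ 2 ≤ ⟪T ξ, ξ⟫)
    (A : H →L[ℝ] H)
    (hAdef : A = G ∘L T ∘L (ContinuousLinearMap.adjoint G))
    (hAsa : ∀ f h : H, ⟪A f, h⟫ = ⟪f, A h⟫)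
    (S : H →L[ℝ] H)
    (hSsa : ∀ f h : H, ⟪S f, h⟫ = ⟪f, S h⟫)
    (hSpos : ∀ f : H, 0 ≤ ⟪S f, f⟫)
    (hSS : S ∘L S = A) :
    Set.range S = Set.range G := by
  obtain ⟨c, hc, hT⟩ := hT
  have hS : ContinuousLinearMap.adjoint S = S :=
    ((ContinuousLinearMap.eq_adjoint_iff S S).2 hSsa).symm
  have key : ∀ f, ‖S f‖ ^ 2 =
      ⟪T (ContinuousLinearMap.adjoint G f), ContinuousLinearMap.adjoint G f⟫ := fun f => by
    rw [ContinuousLinearMap.adjoint_inner_right, ← real_inner_self_eq_norm_sq, ← hSsa]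
    exact congrArg (fun B : H →L[ℝ] H => ⟪B f, f⟫) (hSS.trans hAdef)
  apply Set.Subset.antisymm
  · refine range_subset_range_of_norm_adjoint_le S G √‖T‖ fun f => ?_
    rw [hS]
    refine (sq_le_sq₀ (norm_nonneg _) (by positivity)).1 ?_
    rw [key, mul_pow, Real.sq_sqrt (norm_nonneg T), sq, ← mul_assoc]
    exact (real_inner_le_norm _ _).trans
      (mul_le_mul_of_nonneg_right (T.le_opNorm _) (norm_nonneg _))
  · refine range_subset_range_of_norm_adjoint_le G S (√c)⁻¹ fun f => ?_
    rw [hS]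
    refine (sq_le_sq₀ (norm_nonneg _) (by positivity)).1 ?_
    rw [mul_pow, inv_pow, Real.sq_sqrt hc.le, le_inv_mul_iff₀ hc, key]
    exact hT _
end

section
/- Let H and X be real Hilbert spaces and G : X → H a bounded linear operator with Hilbert-space adjoint G* : H → X. Let S : H → H be a positive self-adjoint square root of G ∘ G*, i.e. S is bounded, self-adjoint, satisfies ⟨S f, f⟩ ≥ 0 for all f ∈ H, and S ∘ S = G ∘ G*. Then range(S) = range(G). (This identity underlies the paper's factorization method: the range of |Λ − Λ₀|^{1/2} is compared to the range of the operator G in the symmetric factorization Λ − Λ₀ = G T G*.) -/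
open scoped RealInnerProductSpace

/-- One direction of the Douglas range inclusion theorem: if `‖A* f‖ ≤ ‖B* f‖` for all `f`,
then `range A ⊆ range B`. -/
theorem range_subset_range_of_norm_adjoint_le_s4 {H X Y : Type*}
    [NormedAddCommGroup H] [InnerProductSpace ℝ H] [CompleteSpace H]
    [NormedAddCommGroup X] [InnerProductSpace ℝ X] [CompleteSpace X]
    [NormedAddCommGroup Y] [InnerProductSpace ℝ Y] [CompleteSpace Y]
    (A : X →L[ℝ] H) (B : Y →L[ℝ] H)
    (hAB : ∀ f : H, ‖ContinuousLinearMap.adjoint A f‖ ≤ ‖ContinuousLinearMap.adjoint B f‖) :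
    Set.range A ⊆ Set.range B := by
  rintro _ ⟨x, rfl⟩
  have bound (f : H) : |⟪A x, f⟫| ≤ ‖x‖ * ‖ContinuousLinearMap.adjoint B f‖ := by
    rw [← ContinuousLinearMap.adjoint_inner_right]
    exact (abs_real_inner_le_norm _ _).trans
      (mul_le_mul_of_nonneg_left (hAB f) (norm_nonneg x))
  let T : H →ₗ[ℝ] Y := (ContinuousLinearMap.adjoint B).toLinearMap
  obtain ⟨g, hg⟩ := T.rangeRestrict.exists_rightInverse_of_surjective T.range_rangeRestrict
  have hBg (p : LinearMap.range T) : ContinuousLinearMap.adjoint B (g p) = p :=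
    congrArg Subtype.val (LinearMap.congr_fun hg p)
  let φ : StrongDual ℝ (LinearMap.range T) :=
    LinearMap.mkContinuous ((innerSL ℝ (A x)).toLinearMap ∘ₗ g) ‖x‖ fun p ↦ by
      simpa [hBg] using bound (g p)
  obtain ⟨ψ, hψ, -⟩ := exists_extension_norm_eq (LinearMap.range T) φ
  refine ⟨(InnerProductSpace.toDual ℝ Y).symm ψ, ext_inner_right ℝ fun f ↦ ?_⟩
  have hker : ⟪A x, g (T.rangeRestrict f) - f⟫ = 0 := by
    have h := bound (g (T.rangeRestrict f) - f)
    have h0 : ContinuousLinearMap.adjoint B (g (T.rangeRestrict f) - f) = 0 := by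
      rw [map_sub, hBg]
      exact sub_self _
    rw [h0, norm_zero, mul_zero] at h
    exact abs_nonpos_iff.mp h
  rw [← ContinuousLinearMap.adjoint_inner_right, InnerProductSpace.toDual_symm_apply]
  calc ψ (ContinuousLinearMap.adjoint B f) = φ (T.rangeRestrict f) := hψ (T.rangeRestrict f)
    _ = ⟪A x, g (T.rangeRestrict f)⟫ := rfl
    _ = ⟪A x, f⟫ := by rwa [inner_sub_right, sub_eq_zero] at hker

/-- If `S` is a positive self-adjoint square root of `G G*`, then `range S = range G`. -/
theorem stmt_4 {H X : Type*}
    [NormedAddCommGroup H] [InnerProductSpace ℝ H] [CompleteSpace H]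
    [NormedAddCommGroup X] [InnerProductSpace ℝ X] [CompleteSpace X]
    (G : X →L[ℝ] H)
    (S : H →L[ℝ] H)
    (hSsa : ∀ f h : H, ⟪S f, h⟫ = ⟪f, S h⟫)
    (hSpos : ∀ f : H, 0 ≤ ⟪S f, f⟫)
    (hSS : S ∘L S = G ∘L (ContinuousLinearMap.adjoint G)) :
    Set.range S = Set.range G := by
  have hadj : ContinuousLinearMap.adjoint S = S :=
    ((ContinuousLinearMap.eq_adjoint_iff S S).mpr hSsa).symm
  have hnorm (f : H) :
      ‖ContinuousLinearMap.adjoint S f‖ = ‖ContinuousLinearMap.adjoint G f‖ := by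
    have h : S (S f) = G (ContinuousLinearMap.adjoint G f) := DFunLike.congr_fun hSS f
    rw [hadj, ← sq_eq_sq₀ (norm_nonneg _) (norm_nonneg _), ← real_inner_self_eq_norm_sq,
      ← real_inner_self_eq_norm_sq, hSsa, h, ContinuousLinearMap.adjoint_inner_left]
  exact (range_subset_range_of_norm_adjoint_le_s4 S G fun f ↦ (hnorm f).le).antisymm
    (range_subset_range_of_norm_adjoint_le_s4 G S fun f ↦ (hnorm f).ge)
end

section
/- Let H be a real Hilbert space, P and Q bounded self-adjoint operators on H that are positive and satisfy ⟨P g, g⟩ ≤ ⟨Q g, g⟩ for all g ∈ H. Let S_P and S_Q be positive self-adjoint square roots of P and Q respectively (bounded self-adjoint operators with ⟨S_P f, f⟩ ≥ 0, S_P ∘ S_P = P, and likewise for S_Q). Then range(S_P) ⊆ range(S_Q). (This Douglas-type range inclusion for ordered positive operators is the mechanism behind the range identity Range(|Λ − Λ₀|^{1/2}) = Range(G) used in the paper's factorization method theorem.) -/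
/-- If `‖A g‖ ≤ ‖B g‖` for all `g`, then the range of the adjoint of `A` is contained in the
range of the adjoint of `B`. -/
theorem range_adjoint_subset_of_norm_le {𝕜 E F G : Type*} [RCLike 𝕜]
    [NormedAddCommGroup E] [InnerProductSpace 𝕜 E] [CompleteSpace E]
    [NormedAddCommGroup F] [InnerProductSpace 𝕜 F] [CompleteSpace F]
    [NormedAddCommGroup G] [InnerProductSpace 𝕜 G] [CompleteSpace G]
    {A : E →L[𝕜] F} {B : E →L[𝕜] G} (h : ∀ g, ‖A g‖ ≤ ‖B g‖) :
    Set.range A.adjoint ⊆ Set.range B.adjoint := by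
  rintro _ ⟨x, rfl⟩
  let B' : E →ₗ[𝕜] G := B
  obtain ⟨r, hr⟩ := B'.rangeRestrict.exists_rightInverse_of_surjective B'.range_rangeRestrict
  have hBr (y : LinearMap.range B') : B (r y) = y :=
    congrArg Subtype.val (LinearMap.congr_fun hr y)
  let φ : StrongDual 𝕜 (LinearMap.range B') :=
    (((innerSL 𝕜 x).comp A : E →ₗ[𝕜] 𝕜).comp r).mkContinuous ‖x‖ fun y => by
      calc ‖inner 𝕜 x (A (r y))‖ ≤ ‖x‖ * ‖A (r y)‖ := norm_inner_le_norm _ _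
        _ ≤ ‖x‖ * ‖B (r y)‖ := by gcongr; exact h _
        _ = ‖x‖ * ‖y‖ := by rw [hBr, Submodule.coe_norm]
  obtain ⟨ψ, hψ, -⟩ := exists_extension_norm_eq (LinearMap.range B') φ
  refine ⟨(InnerProductSpace.toDual 𝕜 G).symm ψ, ext_inner_right 𝕜 fun g => ?_⟩
  have hker : A (r (B'.rangeRestrict g)) = A g := by
    rw [← sub_eq_zero, ← map_sub, ← norm_le_zero_iff]
    refine (h _).trans_eq ?_
    rw [map_sub, hBr]
    simp [B']
  calc inner 𝕜 (B.adjoint ((InnerProductSpace.toDual 𝕜 G).symm ψ)) g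
      = ψ (B g) := by
        rw [ContinuousLinearMap.adjoint_inner_left, InnerProductSpace.toDual_symm_apply]
    _ = inner 𝕜 x (A (r (B'.rangeRestrict g))) := hψ (B'.rangeRestrict g)
    _ = inner 𝕜 (A.adjoint x) g := by
        rw [hker, ContinuousLinearMap.adjoint_inner_left]


open scoped RealInnerProductSpace

/-- Douglas-type range inclusion: if `0 ≤ P ≤ Q` (as positive self-adjoint operators)
and `S_P`, `S_Q` are positive self-adjoint square roots of `P`, `Q`, then
`range S_P ⊆ range S_Q`. -/
theorem stmt_5 {H : Type*}
    [NormedAddCommGroup H] [InnerProductSpace ℝ H] [CompleteSpace H]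
    (P Q SP SQ : H →L[ℝ] H)
    (hPsa : ∀ f g : H, ⟪P f, g⟫ = ⟪f, P g⟫)
    (hQsa : ∀ f g : H, ⟪Q f, g⟫ = ⟪f, Q g⟫)
    (hPpos : ∀ g : H, 0 ≤ ⟪P g, g⟫)
    (hQpos : ∀ g : H, 0 ≤ ⟪Q g, g⟫)
    (hle : ∀ g : H, ⟪P g, g⟫ ≤ ⟪Q g, g⟫)
    (hSPsa : ∀ f g : H, ⟪SP f, g⟫ = ⟪f, SP g⟫)
    (hSPpos : ∀ f : H, 0 ≤ ⟪SP f, f⟫)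
    (hSP : SP ∘L SP = P)
    (hSQsa : ∀ f g : H, ⟪SQ f, g⟫ = ⟪f, SQ g⟫)
    (hSQpos : ∀ f : H, 0 ≤ ⟪SQ f, f⟫)
    (hSQ : SQ ∘L SQ = Q) :
    Set.range SP ⊆ Set.range SQ := by
  have hP : SP.adjoint = SP := ((ContinuousLinearMap.eq_adjoint_iff SP SP).2 hSPsa).symm
  have hQ : SQ.adjoint = SQ := ((ContinuousLinearMap.eq_adjoint_iff SQ SQ).2 hSQsa).symm
  rw [← hP, ← hQ]
  refine range_adjoint_subset_of_norm_le fun g => ?_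
  have hg := hle g
  rw [← hSP, ← hSQ, ContinuousLinearMap.comp_apply, ContinuousLinearMap.comp_apply,
    hSPsa, hSQsa, real_inner_self_eq_norm_sq, real_inner_self_eq_norm_sq] at hg
  exact (sq_le_sq₀ (norm_nonneg _) (norm_nonneg _)).1 hg
end
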